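/- Assume k is a field, and let λ_1, λ_2, …, λ_n ∈ k. Then the set of eigenvalues of the k-linear endomorphism R(λ_1 t_1 + λ_2 t_2 + ⋯ + λ_n t_n) of k[S_n] equals {λ_1 m_{I,1} + λ_2 m_{I,2} + ⋯ + λ_n m_{I,n} : I ⊆ [n−1] is lacunar}. -/

import Mathlib

noncomputable section

namespace OneSidedCycleShuffles

/-- `sw n i` is the simple transposition `s_i ∈ S_n` (1-indexed: it swaps the values `i` and
`i+1` of `[n] = {1,…,n}`, realized on the carrier `Fin n` via the identification
`x ∈ [n] ↔ ⟨x-1⟩ : Fin n`); it is the junk value `1` unless `i ∈ [n-1]`. -/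
def sw (n i : ℕ) : Equiv.Perm (Fin n) :=
  if h : 1 ≤ i ∧ i < n then Equiv.swap ⟨i - 1, by omega⟩ ⟨i, h.2⟩ else 1

/-- `cyc n l j` is the cycle `cyc_{l,l+1,…,j} ∈ S_n` (sending `l,…,j-1,j` to `l+1,…,j,l`),
written as the product `s_l s_{l+1} ⋯ s_{j-1}` of simple transpositions. -/
def cyc (n l j : ℕ) : Equiv.Perm (Fin n) :=
  ((List.range' l (j - l)).map (sw n)).prod

/-- The somewhere-to-below shuffle `t_ℓ = cyc_ℓ + cyc_{ℓ,ℓ+1} + ⋯ + cyc_{ℓ,ℓ+1,…,n} ∈ k[S_n]`. -/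
def t (n : ℕ) (k : Type*) [CommRing k] (l : ℕ) : MonoidAlgebra k (Equiv.Perm (Fin n)) :=
  ∑ j ∈ Finset.Icc l n, MonoidAlgebra.of k (Equiv.Perm (Fin n)) (cyc n l j)

/-- `m_{I,ℓ}` : (the smallest element of the enclosure `{0} ∪ I ∪ {n+1}` that is `≥ ℓ`) `- ℓ`. -/
def mIdx (n : ℕ) (I : Finset ℕ) (l : ℕ) : ℕ :=
  sInf {x : ℕ | (x = 0 ∨ x ∈ I ∨ x = n + 1) ∧ l ≤ x} - l

/-- The non-shadow `I' = [n-1] \ (I ∪ (I-1))`. -/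
def nonShadow (n : ℕ) (I : Finset ℕ) : Finset ℕ :=
  Finset.Icc 1 (n - 1) \ (I ∪ I.image (fun i => i - 1))

/-- A set of integers is lacunar if it contains no two consecutive integers. -/
def Lacunar (I : Finset ℕ) : Prop := ∀ i ∈ I, i + 1 ∉ I

instance : DecidablePred Lacunar := fun I =>
  decidable_of_iff (∀ i ∈ I, i + 1 ∉ I) Iff.rfl

/-- The invariant space `F(I) = {q ∈ k[S_n] : q s_i = q for all i ∈ I'}`. -/
def F (n : ℕ) (k : Type*) [CommRing k] (I : Finset ℕ) :
    Submodule k (MonoidAlgebra k (Equiv.Perm (Fin n))) where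
  carrier := {q | ∀ i ∈ nonShadow n I, q * MonoidAlgebra.of k (Equiv.Perm (Fin n)) (sw n i) = q}
  add_mem' := by
    intro a b ha hb i hi
    rw [add_mul, ha i hi, hb i hi]
  zero_mem' := by
    intro i hi
    rw [zero_mul]
  smul_mem' := by
    intro c a ha i hi
    rw [smul_mul_assoc, ha i hi]

/-- `F(<c) = ∑_{J ⊆ [n], sum J < c} F(J)`. -/
def Flt (n : ℕ) (k : Type*) [CommRing k] (c : ℕ) :
    Submodule k (MonoidAlgebra k (Equiv.Perm (Fin n))) :=
  ∑ J ∈ (Finset.Icc 1 n).powerset.filter (fun J => J.sum id < c), F n k J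

/-- `F_i = F(Q_1) + ⋯ + F(Q_i)` for an enumeration `Q` of the lacunar subsets of `[n-1]`. -/
def Fi (n : ℕ) (k : Type*) [CommRing k] (Q : ℕ → Finset ℕ) (i : ℕ) :
    Submodule k (MonoidAlgebra k (Equiv.Perm (Fin n))) :=
  ∑ j ∈ Finset.Icc 1 i, F n k (Q j)

/-- The (1-indexed) value `w(i) ∈ [n]` of a permutation `w ∈ S_n` at `i ∈ [n]`
(junk value `0` if out of range). -/
def pval (n : ℕ) (w : Equiv.Perm (Fin n)) (i : ℕ) : ℕ :=
  if h : i - 1 < n then (w ⟨i - 1, h⟩).val + 1 else 0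

/-- The descent set `Des w = {i ∈ [n-1] : w(i) > w(i+1)}`. -/
def Des (n : ℕ) (w : Equiv.Perm (Fin n)) : Finset ℕ :=
  (Finset.Icc 1 (n - 1)).filter fun i => pval n w (i + 1) < pval n w i

/-- `G(T)` : the subgroup of `S_n` generated by the simple transpositions `s_i`, `i ∈ T`. -/
def G (n : ℕ) (T : Finset ℕ) : Subgroup (Equiv.Perm (Fin n)) :=
  Subgroup.closure ((T.image (sw n) : Finset (Equiv.Perm (Fin n))) : Set (Equiv.Perm (Fin n)))

open scoped Classical in
/-- `a_w = ∑_{σ ∈ G(Des w)} wσ ∈ k[S_n]`. -/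
def aw (n : ℕ) (k : Type*) [CommRing k] (w : Equiv.Perm (Fin n)) :
    MonoidAlgebra k (Equiv.Perm (Fin n)) :=
  ∑ σ ∈ Finset.univ.filter (fun σ => σ ∈ G n (Des n w)),
    MonoidAlgebra.of k (Equiv.Perm (Fin n)) (w * σ)

/-- The Q-index of `w` : the smallest `i ∈ [f_{n+1}]` with `Q_i' ⊆ Des w`. -/
def Qind (n : ℕ) (Q : ℕ → Finset ℕ) (w : Equiv.Perm (Fin n)) : ℕ :=
  sInf {i : ℕ | 1 ≤ i ∧ i ≤ Nat.fib (n + 1) ∧ nonShadow n (Q i) ⊆ Des n w}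

/-- The set of inversions of `u ∈ S_n` : pairs `(i,j) ∈ [n] × [n]` with `i < j`, `u(i) > u(j)`. -/
def InvSet (n : ℕ) (u : Equiv.Perm (Fin n)) : Finset (ℕ × ℕ) :=
  (Finset.Icc 1 n ×ˢ Finset.Icc 1 n).filter fun p => p.1 < p.2 ∧ pval n u p.2 < pval n u p.1

/-- The lexicographic order on `S_n` : `u < v` iff at the smallest `i ∈ [n]` where they
differ, `u(i) < v(i)`. -/
def lexLT (n : ℕ) (u v : Equiv.Perm (Fin n)) : Prop :=
  ∃ i ∈ Finset.Icc 1 n, pval n u i < pval n v i ∧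
    ∀ j ∈ Finset.Icc 1 n, j < i → pval n u j = pval n v j

/-- `Z(I) = {q ∈ k[S_n] : q s_i = q for all i ∈ I}`. -/
def Z (n : ℕ) (k : Type*) [CommRing k] (I : Finset ℕ) :
    Submodule k (MonoidAlgebra k (Equiv.Perm (Fin n))) where
  carrier := {q | ∀ i ∈ I, q * MonoidAlgebra.of k (Equiv.Perm (Fin n)) (sw n i) = q}
  add_mem' := by
    intro a b ha hb i hi
    rw [add_mul, ha i hi, hb i hi]
  zero_mem' := by
    intro i hi
    rw [zero_mul]
  smul_mem' := by
    intro c a ha i hi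
    rw [smul_mul_assoc, ha i hi]

/-- `R(x)` : right multiplication by `x`, as a `k`-module endomorphism of `k[S_n]`. -/
def Rmul (n : ℕ) (k : Type*) [CommRing k] (x : MonoidAlgebra k (Equiv.Perm (Fin n))) :
    Module.End k (MonoidAlgebra k (Equiv.Perm (Fin n))) :=
  LinearMap.mulRight k x


section Coxeter

theorem sw_mul_self (n i : ℕ) : sw n i * sw n i = 1 := by
  unfold sw
  split_ifs <;> simp

theorem sw_apply_lt_iff {n i j : ℕ} (h : j ≠ i) (x : Fin n) :
    (sw n j x : ℕ) < i ↔ (x : ℕ) < i := by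
  unfold sw
  split_ifs with hj
  · rw [Equiv.swap_apply_def]
    split_ifs with h₁ h₂
    · subst h₁; simp only; omega
    · subst h₂; simp only; omega
    · rfl
  · rfl

theorem sw_comm {n i j : ℕ} (h : i + 1 < j) : sw n i * sw n j = sw n j * sw n i := by
  unfold sw
  split_ifs with h₁ h₂ h₂
  · refine (Equiv.Perm.disjoint_swap_swap ?_).commute
    simp only [List.nodup_cons, List.mem_cons, Fin.mk.injEq, List.not_mem_nil, or_false,
      List.nodup_nil, and_true, not_false_eq_true]
    omega
  all_goals simp

theorem sw_braid {n i : ℕ} (h₁ : 1 ≤ i) (h₂ : i + 1 < n) :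
    sw n i * sw n (i + 1) * sw n i = sw n (i + 1) * sw n i * sw n (i + 1) := by
  unfold sw
  rw [dif_pos ⟨h₁, by omega⟩, dif_pos ⟨by omega, h₂⟩]
  have key : ∀ a b c : Fin n, a ≠ b → a ≠ c → b ≠ c → Equiv.swap a b * Equiv.swap b c *
      Equiv.swap a b = Equiv.swap b c * Equiv.swap a b * Equiv.swap b c := by
    intro a b c hab hac hbc
    rw [Equiv.swap_mul_swap_mul_swap hab hac, Equiv.swap_comm a b, Equiv.swap_comm b c,
      Equiv.swap_mul_swap_mul_swap hbc.symm hac.symm, Equiv.swap_comm]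
  apply key <;> simp only [ne_eq, Fin.mk.injEq] <;> omega

theorem cyc_self (n l : ℕ) : cyc n l l = 1 := by simp [cyc]

theorem cyc_succ {n l j : ℕ} (h : l ≤ j) : cyc n l (j + 1) = cyc n l j * sw n j := by
  unfold cyc
  rw [Nat.succ_sub h, List.range'_1_concat]
  simp [Nat.add_sub_cancel' h]

theorem cyc_succ_mul_sw {n l j : ℕ} (h : l ≤ j) : cyc n l (j + 1) * sw n j = cyc n l j := by
  rw [cyc_succ h, mul_assoc, sw_mul_self, mul_one]

theorem cyc_mul_cyc {n l m j : ℕ} (h₁ : l ≤ m) (h₂ : m ≤ j) :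
    cyc n l m * cyc n m j = cyc n l j := by
  induction j, h₂ using Nat.le_induction with
  | base => rw [cyc_self, mul_one]
  | succ j hj ih => rw [cyc_succ hj, cyc_succ (h₁.trans hj), ← mul_assoc, ih]

theorem cyc_mul_sw_of_far {n l j i : ℕ} (h : l ≤ j) (hi : i + 1 < l ∨ j < i) :
    cyc n l j * sw n i = sw n i * cyc n l j := by
  induction j, h using Nat.le_induction with
  | base => simp [cyc_self]
  | succ j hj ih =>
    have h₁ : sw n j * sw n i = sw n i * sw n j := by
      rcases hi with hi | hi
      · exact (sw_comm (by omega)).symm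
      · exact sw_comm (by omega)
    rw [cyc_succ hj, mul_assoc, h₁, ← mul_assoc, ih (by omega), mul_assoc]

theorem cyc_mul_sw_of_mem {n l j i : ℕ} (hl : 1 ≤ l) (hi : l ≤ i) (hj : i + 2 ≤ j) (hn : j ≤ n) :
    cyc n l j * sw n i = sw n (i + 1) * cyc n l j := by
  induction j, hj using Nat.le_induction with
  | base =>
    rw [cyc_succ (by omega), cyc_succ hi]
    have h := sw_braid (n := n) (i := i) (by omega) (by omega)
    calc cyc n l i * sw n i * sw n (i + 1) * sw n i
        = cyc n l i * (sw n i * sw n (i + 1) * sw n i) := by simp only [mul_assoc]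
      _ = cyc n l i * sw n (i + 1) * sw n i * sw n (i + 1) := by rw [h]; simp only [mul_assoc]
      _ = _ := by rw [cyc_mul_sw_of_far hi (by omega)]; simp only [mul_assoc]
  | succ j hj ih =>
    rw [cyc_succ (by omega), mul_assoc, ← sw_comm (by omega), ← mul_assoc, ih (by omega),
      mul_assoc]

end Coxeter

section Shuffles

variable {n : ℕ} {k : Type*} [Field k]

open MonoidAlgebra

theorem mem_nonShadow {I : Finset ℕ} {i : ℕ} :
    i ∈ nonShadow n I ↔ (1 ≤ i ∧ i < n) ∧ i ∉ I ∧ i + 1 ∉ I := by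
  simp only [nonShadow, Finset.mem_sdiff, Finset.mem_Icc, Finset.mem_union, Finset.mem_image,
    not_or, not_exists, not_and]
  constructor
  · rintro ⟨⟨h₁, h₂⟩, h₃, h₄⟩
    exact ⟨⟨h₁, by omega⟩, h₃, fun h => h₄ _ h (by omega)⟩
  · rintro ⟨⟨h₁, h₂⟩, h₃, h₄⟩
    refine ⟨⟨h₁, by omega⟩, h₃, fun x hx hxi => h₄ ?_⟩
    rwa [show i + 1 = x by omega]

theorem F_mono {I J : Finset ℕ} (h : nonShadow n J ⊆ nonShadow n I) : F n k I ≤ F n k J :=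
  fun _ hq i hi => hq i (h hi)

theorem mul_of_cyc_eq_self {I : Finset ℕ} {q : MonoidAlgebra k (Equiv.Perm (Fin n))}
    (hq : q ∈ F n k I) {l j : ℕ} (hlj : l ≤ j) (h : ∀ i, l ≤ i → i < j → i ∈ nonShadow n I) :
    q * of k _ (cyc n l j) = q := by
  induction j, hlj using Nat.le_induction with
  | base => rw [cyc_self, map_one, mul_one]
  | succ j hj ih =>
    rw [cyc_succ hj, map_mul, ← mul_assoc, ih fun i h₁ h₂ => h i h₁ (by omega)]
    exact hq j (h j hj (by omega))

/-- The set obtained from `I` by lowering each element in `[l, p]` by one. -/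
def lower (I : Finset ℕ) (l p : ℕ) : Finset ℕ :=
  I.image fun x => if l ≤ x ∧ x ≤ p then x - 1 else x

theorem sum_lower_lt {I : Finset ℕ} {l p : ℕ} (hl : 1 ≤ l) (hlp : l ≤ p) (hp : p ∈ I) :
    (lower I l p).sum id < I.sum id := by
  calc (lower I l p).sum id ≤ ∑ x ∈ I, if l ≤ x ∧ x ≤ p then x - 1 else x :=
        Finset.sum_image_le_of_nonneg (fun _ _ => Nat.zero_le _)
    _ < I.sum id := by
        refine Finset.sum_lt_sum (fun x _ => ?_) ⟨p, hp, ?_⟩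
        · split_ifs <;> simp
        · rw [if_pos ⟨hlp, le_rfl⟩]; simp only [id]; omega

theorem mem_nonShadow_lower {I : Finset ℕ} {l p i : ℕ} (h : i ∈ nonShadow n (lower I l p)) :
    (1 ≤ i ∧ i < n) ∧ ∀ x ∈ I, (l ≤ x → x ≤ p → i + 1 ≠ x ∧ i + 2 ≠ x) ∧
      (x < l ∨ p < x → i ≠ x ∧ i + 1 ≠ x) := by
  obtain ⟨h₁, h₂, h₃⟩ := mem_nonShadow.1 h
  refine ⟨h₁, fun x hx => ?_⟩
  simp only [lower, Finset.mem_image, not_exists, not_and] at h₂ h₃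
  have h₂ := h₂ x hx
  have h₃ := h₃ x hx
  split_ifs at h₂ h₃ <;> omega

/-- The positions `j ≥ p` with no element of `I` in `(p, j]`. -/
def block (n : ℕ) (I : Finset ℕ) (p : ℕ) : Finset ℕ :=
  (Finset.Icc p n).filter fun j => ∀ x ∈ I, x ≤ j → x ≤ p

theorem mem_block {I : Finset ℕ} {p j : ℕ} :
    j ∈ block n I p ↔ (p ≤ j ∧ j ≤ n) ∧ ∀ x ∈ I, x ≤ j → x ≤ p := by
  simp [block]

theorem sum_block_mem {I : Finset ℕ} {q : MonoidAlgebra k (Equiv.Perm (Fin n))}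
    (hq : q ∈ F n k I) {l p : ℕ} (hl : 1 ≤ l) (hlp : l ≤ p) (hp : p ∈ I)
    (hlI : l ∈ I ∨ l + 1 ∈ I) :
    ∑ j ∈ block n I p, q * of k _ (cyc n l j) ∈ F n k (lower I l p) := by
  intro i hi
  obtain ⟨⟨hi₁, hin⟩, hK⟩ := mem_nonShadow_lower hi
  rw [Finset.sum_mul]
  have key : ∀ g h : Equiv.Perm (Fin n), ∀ i', i' ∈ nonShadow n I → g * sw n i = sw n i' * h →
      q * of k _ g * of k _ (sw n i) = q * of k _ h := by
    intro g h i' hi' e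
    rw [mul_assoc, ← map_mul, e, map_mul, ← mul_assoc, hq i' hi']
  have hpp := (hK p hp).1 hlp le_rfl
  by_cases hip : p ≤ i
  · refine Finset.sum_equiv (Equiv.swap i (i + 1)) (fun j => ?_) (fun j hj => ?_)
    · have hI : i + 1 ∉ I := fun h => ((hK _ h).2 (by omega)).2 rfl
      have hiff : (∀ x ∈ I, x ≤ i → x ≤ p) ↔ (∀ x ∈ I, x ≤ i + 1 → x ≤ p) := by
        refine ⟨fun h x hx hxi => ?_, fun h x hx hxi => h x hx (by omega)⟩
        have : x ≠ i + 1 := fun e => hI (e ▸ hx)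
        exact h x hx (by omega)
      rw [mem_block, mem_block, Equiv.swap_apply_def]
      split_ifs with h₁ h₂
      · subst h₁; rw [hiff]; apply and_congr_left; omega
      · subst h₂; rw [← hiff]; apply and_congr_left; omega
      · rfl
    · obtain ⟨⟨hpj, hjn⟩, hj⟩ := mem_block.1 hj
      rw [Equiv.swap_apply_def]
      split_ifs with h₁ h₂
      · subst h₁
        rw [cyc_succ (by omega), map_mul, mul_assoc]
      · subst h₂
        rw [mul_assoc, ← map_mul, cyc_succ_mul_sw (by omega)]
      · rcases lt_or_ge j i with hji | hji
        · refine key _ _ i (mem_nonShadow.2 ⟨⟨hi₁, hin⟩, fun h => ?_, fun h => ?_⟩)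
            (cyc_mul_sw_of_far (by omega) (Or.inr hji))
          · exact ((hK _ h).2 (by omega)).1 rfl
          · exact ((hK _ h).2 (by omega)).2 rfl
        · refine key _ _ (i + 1) (mem_nonShadow.2 ⟨⟨by omega, by omega⟩, fun h => ?_, fun h => ?_⟩)
            (cyc_mul_sw_of_mem hl (by omega) (by omega) hjn)
          · have := hj _ h (by omega); omega
          · have := hj _ h (by omega); omega
  · refine Finset.sum_congr rfl fun j hj => ?_
    obtain ⟨⟨hpj, hjn⟩, -⟩ := mem_block.1 hj
    rcases lt_or_ge (i + 1) l with hil | hil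
    · refine key _ _ i (mem_nonShadow.2 ⟨⟨hi₁, hin⟩, fun h => ?_, fun h => ?_⟩)
        (cyc_mul_sw_of_far (by omega) (Or.inl hil))
      · exact ((hK _ h).2 (by omega)).1 rfl
      · exact ((hK _ h).2 (by omega)).2 rfl
    · have hli : l ≤ i := by
        by_contra hlt
        rcases hlI with h | h
        · have := (hK _ h).1 le_rfl hlp
          omega
        · have := (hK _ h).1 (by omega) (by omega)
          omega
      refine key _ _ (i + 1) (mem_nonShadow.2 ⟨⟨by omega, by omega⟩, fun h => ?_, fun h => ?_⟩)
        (cyc_mul_sw_of_mem hl hli (by omega) hjn)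
      · rcases le_or_gt (i + 1) p with h' | h'
        · exact ((hK _ h).1 (by omega) h').1 rfl
        · omega
      · exact ((hK _ h).1 (by omega) (by omega)).2 rfl

theorem exists_lacunar_nonShadow_subset (n : ℕ) (I : Finset ℕ) :
    ∃ K : Finset ℕ, K ⊆ Finset.Icc 1 (n - 1) ∧ Lacunar K ∧ K.sum id ≤ I.sum id ∧
      nonShadow n K ⊆ nonShadow n I := by
  induction hs : I.sum id using Nat.strong_induction_on generalizing I with
  | _ s ih =>
    subst hs
    set I₁ := I ∩ Finset.Icc 1 n with hI₁
    have hsum : I₁.sum id ≤ I.sum id := Finset.sum_le_sum_of_subset Finset.inter_subset_left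
    have hsub : nonShadow n I₁ ⊆ nonShadow n I := by
      intro i
      simp only [mem_nonShadow, hI₁, Finset.mem_inter, Finset.mem_Icc]
      rintro ⟨h₁, h₂, h₃⟩
      exact ⟨h₁, fun h => h₂ ⟨h, by omega⟩, fun h => h₃ ⟨h, by omega⟩⟩
    have lowering : ∀ x y, x ∈ I₁ → y < x →
        nonShadow n (insert y (I₁.erase x)) ⊆ nonShadow n I₁ → ∃ K : Finset ℕ,
          K ⊆ Finset.Icc 1 (n - 1) ∧ Lacunar K ∧ K.sum id ≤ I.sum id ∧
            nonShadow n K ⊆ nonShadow n I := by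
      intro x y hx hyx hsh
      have hlt : (insert y (I₁.erase x)).sum id < I.sum id := by
        have h₁ := Finset.add_sum_erase I₁ id hx
        have h₂ : (insert y (I₁.erase x)).sum id ≤ y + (I₁.erase x).sum id := by
          by_cases hy : y ∈ I₁.erase x
          · rw [Finset.insert_eq_of_mem hy]; omega
          · rw [Finset.sum_insert hy]; rfl
        simp only [id] at h₁ h₂ hsum ⊢
        omega
      obtain ⟨K, h₁, h₂, h₃, h₄⟩ := ih _ hlt _ rfl
      exact ⟨K, h₁, h₂, h₃.trans hlt.le, h₄.trans (hsh.trans hsub)⟩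
    by_cases hn : n ∈ I₁
    · have hn1 : 1 ≤ n := (Finset.mem_Icc.1 (Finset.mem_inter.1 hn).2).1
      refine lowering n (n - 1) hn (by omega) fun i => ?_
      simp only [mem_nonShadow, Finset.mem_insert, Finset.mem_erase]
      rintro ⟨h₁, h₂, h₃⟩
      exact ⟨h₁, fun h => h₂ (Or.inr ⟨by omega, h⟩), fun h => h₃ (Or.inr ⟨by omega, h⟩)⟩
    by_cases hL : Lacunar I₁
    · refine ⟨I₁, fun i hi => ?_, hL, hsum, hsub⟩
      have h := Finset.mem_Icc.1 (Finset.mem_inter.1 hi).2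
      have : i ≠ n := fun e => hn (e ▸ hi)
      exact Finset.mem_Icc.2 (by omega)
    · simp only [Lacunar, not_forall, not_not] at hL
      obtain ⟨x, hx, hx'⟩ := hL
      have hx1 : 1 ≤ x := (Finset.mem_Icc.1 (Finset.mem_inter.1 hx).2).1
      refine lowering x (x - 1) hx (by omega) fun i => ?_
      simp only [mem_nonShadow, Finset.mem_insert, Finset.mem_erase]
      rintro ⟨h₁, h₂, h₃⟩
      refine ⟨h₁, fun h => h₂ (Or.inr ⟨?_, h⟩), fun h => h₃ (Or.inr ⟨?_, h⟩)⟩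
      · rintro rfl
        exact h₃ (Or.inr ⟨by omega, hx'⟩)
      · rintro rfl
        exact h₂ (Or.inl (by omega))

/-- The sum of the spaces `F(J)` over the lacunar `J ⊆ [n-1]` with `sum J < c`. -/
def lacunarSpan (n : ℕ) (k : Type*) [Field k] (c : ℕ) :
    Submodule k (MonoidAlgebra k (Equiv.Perm (Fin n))) :=
  ⨆ J : {J : Finset ℕ // J ⊆ Finset.Icc 1 (n - 1) ∧ Lacunar J ∧ J.sum id < c}, F n k J

theorem F_le_lacunarSpan {I : Finset ℕ} {c : ℕ} (h : I.sum id < c) :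
    F n k I ≤ lacunarSpan n k c := by
  obtain ⟨K, h₁, h₂, h₃, h₄⟩ := exists_lacunar_nonShadow_subset n I
  exact (F_mono h₄).trans (le_iSup (fun J : {J : Finset ℕ // J ⊆ Finset.Icc 1 (n - 1) ∧
    Lacunar J ∧ J.sum id < c} => F n k J) ⟨K, h₁, h₂, h₃.trans_lt h⟩)

theorem lacunarSpan_le {c : ℕ} {V : Submodule k (MonoidAlgebra k (Equiv.Perm (Fin n)))}
    (h : ∀ J : Finset ℕ, J ⊆ Finset.Icc 1 (n - 1) → Lacunar J → J.sum id < c → F n k J ≤ V) :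
    lacunarSpan n k c ≤ V :=
  iSup_le fun J => h J J.2.1 J.2.2.1 J.2.2.2

theorem lacunarSpan_mono {c d : ℕ} (h : c ≤ d) : lacunarSpan n k c ≤ lacunarSpan n k d :=
  lacunarSpan_le fun _ _ _ hJ => F_le_lacunarSpan (hJ.trans_le h)

theorem exists_lacunarSpan_eq_top (n : ℕ) (k : Type*) [Field k] :
    ∃ c, lacunarSpan n k c = ⊤ := by
  refine ⟨(Finset.Icc 1 n).sum id + 1, top_le_iff.1 fun q _ =>
    F_le_lacunarSpan (Nat.lt_succ_self _) fun i hi => ?_⟩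
  obtain ⟨h₁, h₂, -⟩ := mem_nonShadow.1 hi
  exact absurd (Finset.mem_Icc.2 ⟨h₁.1, h₁.2.le⟩) h₂

theorem mul_t_sub_mem {I : Finset ℕ} {q : MonoidAlgebra k (Equiv.Perm (Fin n))}
    (hq : q ∈ F n k I) {l : ℕ} (hl : 1 ≤ l) (hln : l ≤ n) :
    q * t n k l - (mIdx n I l : k) • q ∈ lacunarSpan n k (I.sum id) := by
  unfold mIdx
  set E := {x : ℕ | (x = 0 ∨ x ∈ I ∨ x = n + 1) ∧ l ≤ x}
  set m := sInf E
  have hmem : m ∈ E := Nat.sInf_mem ⟨n + 1, Or.inr (Or.inr rfl), by omega⟩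
  have hmin : ∀ x ∈ I, l ≤ x → m ≤ x := fun x hx hlx => Nat.sInf_le ⟨Or.inr (Or.inl hx), hlx⟩
  have hmn : m ≤ n + 1 := Nat.sInf_le ⟨Or.inr (Or.inr rfl), by omega⟩
  have hlm : l ≤ m := hmem.2
  have hns : ∀ i, l ≤ i → i + 1 < m → i ∈ nonShadow n I := by
    intro i h₁ h₂
    refine mem_nonShadow.2 ⟨by omega, fun h => ?_, fun h => ?_⟩
    · have := hmin _ h h₁; omega
    · have := hmin _ h (by omega); omega
  have hsplit : q * t n k l = ∑ j ∈ Finset.Ico l m, q * of k _ (cyc n l j) +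
      ∑ j ∈ Finset.Ico m (n + 1), q * of k _ (cyc n l j) := by
    rw [t, Finset.mul_sum, Finset.sum_Ico_consecutive _ hlm hmn]
    rfl
  have hfst : ∑ j ∈ Finset.Ico l m, q * of k _ (cyc n l j) = ((m - l : ℕ) : k) • q := by
    rw [Finset.sum_congr rfl (g := fun _ => q), Finset.sum_const, Nat.card_Ico,
      Nat.cast_smul_eq_nsmul]
    intro j hj
    rw [Finset.mem_Ico] at hj
    exact mul_of_cyc_eq_self hq hj.1 fun i h₁ h₂ => hns i h₁ (by omega)
  rw [hsplit, hfst, add_sub_cancel_left]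
  have hmI : m ≤ n → m ∈ I := by
    intro h
    rcases hmem.1 with h' | h' | h'
    · omega
    · exact h'
    · omega
  set l' := max l (m - 1) with hl'
  have hred : ∀ j ∈ Finset.Ico m (n + 1),
      q * of k _ (cyc n l j) = q * of k _ (cyc n l' j) := by
    intro j hj
    rw [Finset.mem_Ico] at hj
    rw [← cyc_mul_cyc (show l ≤ l' by omega) (show l' ≤ j by omega), map_mul, ← mul_assoc,
      mul_of_cyc_eq_self hq (by omega) fun i h₁ h₂ => hns i h₁ (by omega)]
  rw [Finset.sum_congr rfl hred]
  have hlast : ∀ j ∈ Finset.Ico m (n + 1),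
      (I.filter (· ≤ j)).sup id ∈ I.filter fun p => m ≤ p ∧ p ≤ n := by
    intro j hj
    rw [Finset.mem_Ico] at hj
    have hne : m ∈ I.filter (· ≤ j) := Finset.mem_filter.2 ⟨hmI (by omega), hj.1⟩
    obtain ⟨p, hp, hp'⟩ := Finset.exists_mem_eq_sup _ ⟨m, hne⟩ id
    have hmp : m ≤ (I.filter (· ≤ j)).sup id := Finset.le_sup (f := id) hne
    rw [hp'] at hmp ⊢
    simp only [id, Finset.mem_filter] at *
    exact ⟨hp.1, hmp, by omega⟩
  rw [← Finset.sum_fiberwise_of_maps_to hlast]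
  refine Submodule.sum_mem _ fun p hp => ?_
  obtain ⟨hpI, hmp, hpn⟩ := Finset.mem_filter.1 hp
  have hblock : (Finset.Ico m (n + 1)).filter (fun j => (I.filter (· ≤ j)).sup id = p) =
      block n I p := by
    ext j
    rw [mem_block, Finset.mem_filter, Finset.mem_Ico]
    constructor
    · rintro ⟨h₁, rfl⟩
      exact ⟨⟨Finset.sup_le fun x hx => (Finset.mem_filter.1 hx).2, by omega⟩,
        fun x hx hxj => Finset.le_sup (f := id) (Finset.mem_filter.2 ⟨hx, hxj⟩)⟩
    · rintro ⟨h₁, h₂⟩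
      refine ⟨by omega, le_antisymm (Finset.sup_le fun x hx => ?_)
        (Finset.le_sup (f := id) (Finset.mem_filter.2 ⟨hpI, h₁.1⟩))⟩
      exact h₂ x (Finset.mem_filter.1 hx).1 (Finset.mem_filter.1 hx).2
  rw [hblock]
  have hl'I : l' ∈ I ∨ l' + 1 ∈ I := by
    rcases hlm.eq_or_lt with h | h
    · left
      rw [show l' = m by omega]
      exact hmI (by omega)
    · right
      rw [show l' + 1 = m by omega]
      exact hmI (by omega)
  exact F_le_lacunarSpan (sum_lower_lt (by omega) (by omega) hpI)
    (sum_block_mem hq (by omega) (by omega) hpI hl'I)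

theorem sum_le_sum_of_shift {I J : Finset ℕ} (hI : Lacunar I)
    (h : ∀ i ∈ I, i ∈ J ∨ i + 1 ∈ J) : I.sum id ≤ J.sum id := by
  calc I.sum id ≤ ∑ i ∈ I, if i ∈ J then i else i + 1 :=
        Finset.sum_le_sum fun i _ => by split_ifs <;> simp
    _ = (I.image fun i => if i ∈ J then i else i + 1).sum id := by
        rw [Finset.sum_image]
        · rfl
        · intro x hx y hy hxy
          have h₁ := hI x hx
          have h₂ := hI y hy
          simp only at hxy
          split_ifs at hxy
          · exact hxy
          · subst hxy; exact absurd hx h₂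
          · subst hxy; exact absurd hy h₁
          · omega
    _ ≤ J.sum id := by
        refine Finset.sum_le_sum_of_subset (Finset.image_subset_iff.2 fun i hi => ?_)
        split_ifs with h'
        · exact h'
        · exact (h i hi).resolve_left h'

/-- The sum of all permutations preserving `{1, …, i}` for each `i ∈ I`. -/
def youngSum (n : ℕ) (k : Type*) [Field k] (I : Finset ℕ) :
    MonoidAlgebra k (Equiv.Perm (Fin n)) :=
  ofCoeff (Finsupp.equivFunOnFinite.symm fun g =>
    open scoped Classical in if ∀ i ∈ I, ∀ x, (g x : ℕ) < i ↔ (x : ℕ) < i then 1 else 0)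

theorem coeff_youngSum (I : Finset ℕ) (g : Equiv.Perm (Fin n)) :
    (youngSum n k I).coeff g =
      open scoped Classical in if ∀ i ∈ I, ∀ x, (g x : ℕ) < i ↔ (x : ℕ) < i then 1 else 0 :=
  rfl

theorem sw_inv (n i : ℕ) : (sw n i)⁻¹ = sw n i :=
  inv_eq_of_mul_eq_one_left (sw_mul_self n i)

theorem coeff_mul_of_sw (q : MonoidAlgebra k (Equiv.Perm (Fin n))) (i : ℕ)
    (g : Equiv.Perm (Fin n)) :
    (q * of k _ (sw n i)).coeff g = q.coeff (g * sw n i) := by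
  rw [of_apply, coeff_mul_single_apply, mul_one, sw_inv]

theorem mul_sw_apply_lt_iff {i j : ℕ} (h : j ≠ i) (g : Equiv.Perm (Fin n)) :
    (∀ x, ((g * sw n j) x : ℕ) < i ↔ (x : ℕ) < i) ↔ ∀ x, (g x : ℕ) < i ↔ (x : ℕ) < i := by
  rw [← (sw n j).forall_congr_right]
  refine forall_congr' fun x => ?_
  rw [sw_apply_lt_iff h, Equiv.Perm.mul_apply, ← Equiv.Perm.mul_apply (sw n j), sw_mul_self,
    Equiv.Perm.one_apply]

theorem youngSum_mem (I : Finset ℕ) : youngSum n k I ∈ F n k I := by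
  intro i hi
  have hiI := (mem_nonShadow.1 hi).2.1
  ext g
  rw [coeff_mul_of_sw, coeff_youngSum, coeff_youngSum]
  congr 1
  refine propext (forall₂_congr fun j hj => mul_sw_apply_lt_iff ?_ g)
  rintro rfl
  exact hiI hj

/-- `P` plays the role of the product of the factors `1 - s_i` over `i ∈ S`. -/
theorem exists_annihilator {I : Finset ℕ} (hI : I ⊆ Finset.Icc 1 (n - 1)) (hL : Lacunar I)
    (S : Finset ℕ) (hS : S ⊆ I) :
    ∃ P : MonoidAlgebra k (Equiv.Perm (Fin n)),
      (∀ q, ∀ j ∈ S, q * of k _ (sw n j) = q → q * P = 0) ∧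
      (∀ j ∈ I, j ∉ S → P * of k _ (sw n j) = of k _ (sw n j) * P) ∧
      (youngSum n k I * P).coeff 1 = 1 ∧
      ∀ j ∈ I, j ∉ S → ∀ g : Equiv.Perm (Fin n), (¬ ∀ x, (g x : ℕ) < j ↔ (x : ℕ) < j) →
        (youngSum n k I * P).coeff g = 0 := by
  induction S using Finset.induction_on with
  | empty =>
    refine ⟨1, by simp, by simp, ?_, fun j hj _ g hg => ?_⟩
    · rw [mul_one, coeff_youngSum, if_pos]; simp
    · rw [mul_one, coeff_youngSum, if_neg]
      exact fun h => hg (h j hj)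
  | insert i S hi ih =>
    obtain ⟨P, h₁, h₂, h₃, h₄⟩ := ih ((Finset.subset_insert _ _).trans hS)
    have hiI : i ∈ I := hS (Finset.mem_insert_self _ _)
    refine ⟨P * (1 - of k _ (sw n i)), fun q j hj hq => ?_, fun j hj hjS => ?_, ?_,
      fun j hj hjS g hg => ?_⟩
    · rcases Finset.mem_insert.1 hj with rfl | hj
      · rw [mul_sub, mul_one, h₂ j hiI hi, mul_sub, ← mul_assoc q, hq, sub_self]
      · rw [← mul_assoc, h₁ q j hj hq, zero_mul]
    · rw [Finset.mem_insert, not_or] at hjS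
      have hcomm : sw n i * sw n j = sw n j * sw n i := by
        have h₅ : i + 1 ≠ j := fun e => hL i hiI (e ▸ hj)
        have h₆ : j + 1 ≠ i := fun e => hL j hj (e ▸ hiI)
        rcases Nat.lt_or_gt_of_ne hjS.1 with h | h
        · exact (sw_comm (by omega)).symm
        · exact sw_comm (by omega)
      rw [mul_assoc, sub_mul, one_mul, ← map_mul, hcomm, map_mul, ← mul_assoc, ← h₂ j hj hjS.2,
        mul_assoc P, mul_sub (of k _ (sw n j)), mul_one]
    · rw [mul_sub, mul_one, mul_sub, ← mul_assoc, coeff_sub, Finsupp.sub_apply, h₃,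
        coeff_mul_of_sw, one_mul, h₄ i hiI hi, sub_zero]
      intro h
      have hin := Finset.mem_Icc.1 (hI hiI)
      have := h ⟨i - 1, by omega⟩
      rw [sw, dif_pos ⟨hin.1, by omega⟩, Equiv.swap_apply_left] at this
      simp only [lt_self_iff_false, false_iff] at this
      omega
    · rw [Finset.mem_insert, not_or] at hjS
      rw [mul_sub, mul_one, mul_sub, ← mul_assoc, coeff_sub, Finsupp.sub_apply,
        coeff_mul_of_sw, h₄ j hj hjS.2 g hg, h₄ j hj hjS.2, sub_zero]
      rwa [mul_sw_apply_lt_iff (Ne.symm hjS.1)]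

theorem not_F_le_lacunarSpan {I : Finset ℕ} (hI : I ⊆ Finset.Icc 1 (n - 1)) (hL : Lacunar I) :
    ¬ F n k I ≤ lacunarSpan n k (I.sum id) := by
  intro hle
  obtain ⟨P, h₁, -, h₂, -⟩ := exists_annihilator (k := k) hI hL I subset_rfl
  have hker : lacunarSpan n k (I.sum id) ≤ LinearMap.ker (LinearMap.mulRight k P) := by
    refine lacunarSpan_le fun J _ _ hJ q hq => ?_
    obtain ⟨i, hi, hiJ, hiJ'⟩ : ∃ i ∈ I, i ∉ J ∧ i + 1 ∉ J := by
      by_contra! h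
      exact absurd (sum_le_sum_of_shift hL fun i hi => or_iff_not_imp_left.2 (h i hi))
        (not_le.2 hJ)
    have hin := Finset.mem_Icc.1 (hI hi)
    exact h₁ q i hi (hq i (mem_nonShadow.2 ⟨by omega, hiJ, hiJ'⟩))
  have h₀ : youngSum n k I * P = 0 := hker (hle (youngSum_mem I))
  rw [h₀] at h₂
  simp at h₂

theorem Rmul_sub_smul_mem (lam : ℕ → k) {I : Finset ℕ}
    {q : MonoidAlgebra k (Equiv.Perm (Fin n))} (hq : q ∈ F n k I) :
    Rmul n k (∑ l ∈ Finset.Icc 1 n, lam l • t n k l) q -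
      (∑ l ∈ Finset.Icc 1 n, lam l * (mIdx n I l : k)) • q ∈ lacunarSpan n k (I.sum id) := by
  rw [Rmul, LinearMap.mulRight_apply, Finset.mul_sum, Finset.sum_smul, ← Finset.sum_sub_distrib]
  refine Submodule.sum_mem _ fun l hl => ?_
  rw [Finset.mem_Icc] at hl
  rw [mul_smul_comm, mul_smul, ← smul_sub]
  exact Submodule.smul_mem _ _ (mul_t_sub_mem hq hl.1 hl.2)

theorem Rmul_mem_lacunarSpan (lam : ℕ → k) {c : ℕ}
    {q : MonoidAlgebra k (Equiv.Perm (Fin n))} (hq : q ∈ lacunarSpan n k c) :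
    Rmul n k (∑ l ∈ Finset.Icc 1 n, lam l • t n k l) q ∈ lacunarSpan n k c := by
  suffices h : lacunarSpan n k c ≤ (lacunarSpan n k c).comap
      (Rmul n k (∑ l ∈ Finset.Icc 1 n, lam l • t n k l)) from h hq
  refine lacunarSpan_le fun J _ _ hJ p hp => ?_
  have h := lacunarSpan_mono hJ.le (Rmul_sub_smul_mem lam hp)
  rw [Submodule.sub_mem_iff_left _ (Submodule.smul_mem _ _ (F_le_lacunarSpan hJ hp))] at h
  exact h

theorem hasEigenvalue_of_lacunar (lam : ℕ → k) {I : Finset ℕ} (hI : I ⊆ Finset.Icc 1 (n - 1))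
    (hL : Lacunar I) :
    Module.End.HasEigenvalue (Rmul n k (∑ l ∈ Finset.Icc 1 n, lam l • t n k l))
      (∑ l ∈ Finset.Icc 1 n, lam l * (mIdx n I l : k)) := by
  set T := Rmul n k (∑ l ∈ Finset.Icc 1 n, lam l • t n k l)
  set μ := ∑ l ∈ Finset.Icc 1 n, lam l * (mIdx n I l : k)
  set V := lacunarSpan n k (I.sum id)
  by_contra hbot
  rw [Module.End.hasEigenvalue_iff, not_not, Module.End.eigenspace_def] at hbot
  have hinj : Function.Injective ⇑(T - μ • 1) := LinearMap.ker_eq_bot.1 hbot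
  have hmap : (F n k I ⊔ V).map (T - μ • 1) ≤ V := by
    rw [Submodule.map_sup, sup_le_iff]
    constructor
    · rintro _ ⟨q, hq, rfl⟩
      exact Rmul_sub_smul_mem lam hq
    · rintro _ ⟨q, hq, rfl⟩
      exact V.sub_mem (Rmul_mem_lacunarSpan lam hq) (V.smul_mem _ hq)
  have hlt : V < F n k I ⊔ V := right_lt_sup.2 (not_F_le_lacunarSpan hI hL)
  have h₁ := Submodule.finrank_lt_finrank_of_lt hlt
  have h₂ := Submodule.finrank_mono hmap
  rw [← (Submodule.equivMapOfInjective _ hinj (F n k I ⊔ V)).finrank_eq] at h₂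
  omega

theorem exists_lacunar_of_hasEigenvalue (lam : ℕ → k) {μ : k}
    (h : Module.End.HasEigenvalue (Rmul n k (∑ l ∈ Finset.Icc 1 n, lam l • t n k l)) μ) :
    ∃ I : Finset ℕ, I ⊆ Finset.Icc 1 (n - 1) ∧ Lacunar I ∧
      μ = ∑ l ∈ Finset.Icc 1 n, lam l * (mIdx n I l : k) := by
  by_contra! hne
  set T := Rmul n k (∑ l ∈ Finset.Icc 1 n, lam l • t n k l)
  have hrange : ∀ c, lacunarSpan n k c ≤ LinearMap.range (T - μ • 1) := by
    intro c
    induction c using Nat.strong_induction_on with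
    | _ c ih =>
      refine lacunarSpan_le fun J hJ hL hc q hq => ?_
      set ν := ∑ l ∈ Finset.Icc 1 n, lam l * (mIdx n J l : k)
      have h₁ := ih _ hc (Rmul_sub_smul_mem lam hq)
      have h₂ : (T - μ • 1) q ∈ LinearMap.range (T - μ • 1) :=
        LinearMap.mem_range_self _ _
      have h₃ := Submodule.sub_mem _ h₂ h₁
      have h₄ : (T - μ • 1) q - (T q - ν • q) = (ν - μ) • q := by
        rw [LinearMap.sub_apply, LinearMap.smul_apply, Module.End.one_apply, sub_smul]
        abel
      rw [h₄] at h₃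
      exact (Submodule.smul_mem_iff _ (sub_ne_zero.2 (hne J hJ hL).symm)).1 h₃
  obtain ⟨c, hc⟩ := exists_lacunarSpan_eq_top n k
  have hsurj : Function.Surjective ⇑(T - μ • 1) :=
    LinearMap.range_eq_top.1 (top_le_iff.1 (hc ▸ hrange c))
  obtain ⟨v, hv⟩ := h.exists_hasEigenvector
  have hinj : Function.Injective ⇑(T - μ • 1) :=
    LinearMap.injective_iff_surjective.2 hsurj
  refine hv.2 (hinj ?_)
  rw [map_zero, LinearMap.sub_apply, hv.apply_eq_smul, LinearMap.smul_apply, Module.End.one_apply,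
    sub_self]

end Shuffles

/-- Corollary `cor.eigen.spec`. Over a field `k`, the set of eigenvalues
of `R(λ_1 t_1 + ⋯ + λ_n t_n)` equals
`{λ_1 m_{I,1} + ⋯ + λ_n m_{I,n} : I ⊆ [n-1] lacunar}`. -/
theorem spectrum_eq (n : ℕ) (k : Type*) [Field k] (lam : ℕ → k) :
    {μ : k | Module.End.HasEigenvalue
        (Rmul n k (∑ l ∈ Finset.Icc 1 n, lam l • t n k l)) μ} =
      {μ : k | ∃ I : Finset ℕ, I ⊆ Finset.Icc 1 (n - 1) ∧ Lacunar I ∧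
        μ = ∑ l ∈ Finset.Icc 1 n, lam l * (mIdx n I l : k)} := by
  ext μ
  refine ⟨exists_lacunar_of_hasEigenvalue lam, ?_⟩
  rintro ⟨I, hI, hL, rfl⟩
  exact hasEigenvalue_of_lacunar lam hI hL

end OneSidedCycleShuffles
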